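/- arXiv:2111.05162 — 8 statements merged into one kernel-verified Lean document; each statement's English description precedes it below -/
import Mathlib

section
/- Let A be an integral domain, I a finite nonempty set, and R = A[x_i : i ∈ I] the polynomial ring over A in the variables x_i. For J ⊆ I write x_J = ∏_{i∈J} x_i. Let f = Σ_{J⊆I} c_J x_J with coefficients c_J ∈ A. Assume: (i) for every i ∈ I there exists J ⊆ I with i ∈ J and c_J ≠ 0; (ii) the graph with vertex set I, in which two distinct vertices i and j are adjacent if and only if there is no J ⊆ I with i, j ∈ J and c_J ≠ 0, is connected; (iii) the ideal of A generated by all the coefficients c_J equals A. Then f is irreducible in R. -/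
open MvPolynomial

namespace MvPolynomial

/-- If `p` and `q` involve disjoint sets of variables, each coefficient of `p * q` at a sum of
exponents of `p` and `q` is a single product. -/
lemma coeff_add_mul_of_disjoint_vars {σ A : Type*} [CommSemiring A] {p q : MvPolynomial σ A}
    (hpq : Disjoint p.vars q.vars) {m n : σ →₀ ℕ} (hm : m ∈ p.support) (hn : n ∈ q.support) :
    coeff (m + n) (p * q) = coeff m p * coeff n q := by
  classical
  have eq_zero {r : MvPolynomial σ A} {a : σ →₀ ℕ} (ha : a ∈ r.support) {i : σ}
      (hi : i ∉ r.vars) : a i = 0 := mem_support_notMem_vars_zero ha hi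
  rw [coeff_mul, Finset.sum_eq_single (m, n)]
  · rintro ⟨a, b⟩ hab hne
    by_contra h
    have ha : a ∈ p.support := mem_support_iff.mpr (left_ne_zero_of_mul h)
    have hb : b ∈ q.support := mem_support_iff.mpr (right_ne_zero_of_mul h)
    have hsum (i : σ) : a i + b i = m i + n i :=
      DFunLike.congr_fun (Finset.HasAntidiagonal.mem_antidiagonal.mp hab) i
    have ham : a = m := by
      ext i
      by_cases hi : i ∈ p.vars
      · have hi' := Finset.disjoint_left.mp hpq hi
        simpa [eq_zero hb hi', eq_zero hn hi'] using hsum i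
      · rw [eq_zero ha hi, eq_zero hm hi]
    have hbn : b = n := by
      ext i
      have := hsum i
      rw [ham] at this
      omega
    exact hne (by rw [ham, hbn])
  · simp

section Multiaffine

variable {I A : Type*}

lemma sum_C_mul_prod_X_eq_sum_monomial [Fintype I] [CommSemiring A] (c : Finset I → A) :
    ∑ J : Finset I, C (c J) * ∏ i ∈ J, X i =
      ∑ J : Finset I, monomial (∑ i ∈ J, Finsupp.single i 1) (c J) := by
  refine Finset.sum_congr rfl fun J _ => ?_
  simp only [X]
  rw [← monomial_sum_one, C_mul_monomial, mul_one]

lemma sum_single_one_apply [DecidableEq I] (J : Finset I) (i : I) :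
    (∑ k ∈ J, Finsupp.single k (1 : ℕ)) i = if i ∈ J then 1 else 0 := by
  simp [Finsupp.finsetSum_apply, Finsupp.single_apply]

lemma sum_single_one_injective :
    Function.Injective fun J : Finset I => ∑ k ∈ J, Finsupp.single k (1 : ℕ) := by
  classical
  intro J K h
  ext i
  have := DFunLike.congr_fun h i
  simp only [sum_single_one_apply] at this
  split_ifs at this <;> simp_all

variable [Fintype I] [CommSemiring A] (c : Finset I → A)

lemma coeff_sum_C_mul_prod_X (J : Finset I) :
    coeff (∑ i ∈ J, Finsupp.single i 1) (∑ J : Finset I, C (c J) * ∏ i ∈ J, X i) = c J := by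
  classical
  rw [sum_C_mul_prod_X_eq_sum_monomial, coeff_sum, Finset.sum_eq_single J]
  · simp
  · intro K _ hK
    rw [coeff_monomial, if_neg fun h => hK (sum_single_one_injective h)]
  · simp

lemma exists_of_mem_support_sum_C_mul_prod_X {m : I →₀ ℕ}
    (hm : m ∈ (∑ J : Finset I, C (c J) * ∏ i ∈ J, X i).support) :
    ∃ J, c J ≠ 0 ∧ m = ∑ i ∈ J, Finsupp.single i 1 := by
  classical
  rw [mem_support_iff, sum_C_mul_prod_X_eq_sum_monomial, coeff_sum] at hm
  obtain ⟨J, -, hJ⟩ := Finset.exists_ne_zero_of_sum_ne_zero hm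
  rw [coeff_monomial] at hJ
  split_ifs at hJ with h
  · exact ⟨J, hJ, h.symm⟩
  · exact absurd rfl hJ

lemma degreeOf_sum_C_mul_prod_X_le (i : I) :
    degreeOf i (∑ J : Finset I, C (c J) * ∏ i ∈ J, X i) ≤ 1 := by
  classical
  rw [degreeOf_le_iff]
  intro m hm
  obtain ⟨J, -, rfl⟩ := exists_of_mem_support_sum_C_mul_prod_X c hm
  rw [sum_single_one_apply]
  split_ifs <;> simp

lemma mem_vars_sum_C_mul_prod_X {i : I} {J : Finset I} (hi : i ∈ J) (hJ : c J ≠ 0) :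
    i ∈ (∑ J : Finset I, C (c J) * ∏ i ∈ J, X i).vars := by
  classical
  rw [mem_vars_iff_mem_support]
  refine ⟨∑ i ∈ J, Finsupp.single i 1, ?_, ?_⟩
  · rwa [mem_support_iff, coeff_sum_C_mul_prod_X]
  · rw [Finsupp.mem_support_iff, sum_single_one_apply, if_pos hi]
    exact one_ne_zero

end Multiaffine

lemma isUnit_of_vars_eq_empty_of_dvd {I A : Type*} [CommSemiring A]
    {p f : MvPolynomial I A} (hp : p.vars = ∅) (hpf : p ∣ f)
    (hf : Ideal.span (Set.range fun m => coeff m f) = ⊤) : IsUnit p := by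
  obtain ⟨a, rfl⟩ : ∃ a, p = C a := ⟨_, vars_eq_empty_iff_eq_C.mp hp⟩
  refine IsUnit.map C ?_
  rw [← Ideal.span_singleton_eq_top, eq_top_iff, ← hf, Ideal.span_le]
  rintro _ ⟨m, rfl⟩
  exact Ideal.mem_span_singleton.mpr ((C_dvd_iff_dvd_coeff _ _).mp hpf m)

end MvPolynomial

lemma SimpleGraph.Connected.eq_empty_or_eq_empty_of_not_adj {V : Type*} {G : SimpleGraph V}
    (hG : G.Connected) {S T : Set V} (hdisj : Disjoint S T) (hcover : ∀ v, v ∈ S ∨ v ∈ T)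
    (hST : ∀ s ∈ S, ∀ t ∈ T, ¬ G.Adj s t) : S = ∅ ∨ T = ∅ := by
  rw [or_iff_not_imp_left, ← ne_eq, ← Set.nonempty_iff_ne_empty, Set.eq_empty_iff_forall_notMem]
  rintro ⟨s, hs⟩ t ht
  obtain ⟨w⟩ := hG.preconnected s t
  obtain ⟨d, -, hd, hd'⟩ := w.exists_boundary_dart S hs (Set.disjoint_right.mp hdisj ht)
  exact hST _ hd _ ((hcover _).resolve_left hd') d.adj

/-- Let `A` be an integral domain, `I` a finite nonempty set, and
`R = A[x_i : i ∈ I]`. Let `f = Σ_{J ⊆ I} c_J x_J` where `x_J = ∏_{i ∈ J} x_i`.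
Assume (i) every variable occurs in some monomial with nonzero coefficient;
(ii) the graph on `I` where `i ~ j` iff no `J` with `i, j ∈ J` and `c_J ≠ 0`
is connected; (iii) the coefficients generate the unit ideal of `A`.
Then `f` is irreducible in `R`. -/
theorem stmt0 (A : Type*) [CommRing A] [IsDomain A]
    (I : Type*) [Fintype I] [Nonempty I] [DecidableEq I]
    (c : Finset I → A)
    (f : MvPolynomial I A)
    (hf : f = ∑ J : Finset I, MvPolynomial.C (c J) * ∏ i ∈ J, MvPolynomial.X i)
    (h1 : ∀ i : I, ∃ J : Finset I, i ∈ J ∧ c J ≠ 0)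
    (h2 : (SimpleGraph.fromRel
        (fun i j : I => ¬ ∃ J : Finset I, i ∈ J ∧ j ∈ J ∧ c J ≠ 0)).Connected)
    (h3 : Ideal.span (Set.range c) = ⊤) :
    Irreducible f := by
  have hvars (i : I) : i ∈ f.vars := by
    obtain ⟨J, hi, hJ⟩ := h1 i
    exact hf ▸ mem_vars_sum_C_mul_prod_X c hi hJ
  have hdeg (i : I) : degreeOf i f ≤ 1 := hf ▸ degreeOf_sum_C_mul_prod_X_le c i
  have hspan : Ideal.span (Set.range fun m => coeff m f) = ⊤ := by
    rw [eq_top_iff, ← h3]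
    refine Ideal.span_mono ?_
    rintro _ ⟨J, rfl⟩
    exact ⟨_, hf ▸ coeff_sum_C_mul_prod_X c J⟩
  obtain ⟨i₀⟩ := ‹Nonempty I›
  have hf0 : f ≠ 0 := by
    intro h
    simpa [h] using hvars i₀
  refine ⟨fun hu => ?_, fun p q hpq => ?_⟩
  · obtain ⟨a, -, ha⟩ := isUnit_iff_eq_C_of_isReduced.mp hu
    simpa [ha] using hvars i₀
  have hp0 : p ≠ 0 := by rintro rfl; simp [hpq] at hf0
  have hq0 : q ≠ 0 := by rintro rfl; simp [hpq] at hf0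
  have hadd (i : I) : degreeOf i f = degreeOf i p + degreeOf i q := by
    rw [hpq, degreeOf_mul_eq hp0 hq0]
  have hdisj : Disjoint p.vars q.vars := by
    refine Finset.disjoint_left.mpr fun i hip hiq => ?_
    rw [mem_vars_iff_degreeOf_ne_zero] at hip hiq
    have := hadd i
    have := hdeg i
    omega
  have hcover (i : I) : i ∈ (p.vars : Set I) ∨ i ∈ (q.vars : Set I) := by
    have := hvars i
    simp only [Finset.mem_coe, mem_vars_iff_degreeOf_ne_zero] at this ⊢
    have := hadd i
    omega
  have hcommon (i : I) (hi : i ∈ p.vars) (j : I) (hj : j ∈ q.vars) :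
      ∃ J : Finset I, i ∈ J ∧ j ∈ J ∧ c J ≠ 0 := by
    obtain ⟨m, hm, hmi⟩ := (mem_vars_iff_mem_support _).mp hi
    obtain ⟨n, hn, hnj⟩ := (mem_vars_iff_mem_support _).mp hj
    have hmn : m + n ∈ f.support := by
      rw [mem_support_iff, hpq, coeff_add_mul_of_disjoint_vars hdisj hm hn]
      exact mul_ne_zero (mem_support_iff.mp hm) (mem_support_iff.mp hn)
    rw [hf] at hmn
    obtain ⟨J, hJ, hmnJ⟩ := exists_of_mem_support_sum_C_mul_prod_X c hmn
    have hmem (k : I) (hk : (m + n) k ≠ 0) : k ∈ J := by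
      rw [hmnJ, sum_single_one_apply] at hk
      by_contra h
      exact hk (if_neg h)
    rw [Finsupp.mem_support_iff] at hmi hnj
    exact ⟨J, hmem i (by simp [hmi]), hmem j (by simp [hnj]), hJ⟩
  have hempty := h2.eq_empty_or_eq_empty_of_not_adj (Finset.disjoint_coe.mpr hdisj) hcover
    fun i hi j hj hij => by
      obtain ⟨J, hiJ, hjJ, hJ⟩ := hcommon i hi j hj
      rw [SimpleGraph.fromRel_adj] at hij
      exact hij.2.elim (fun h => h ⟨J, hiJ, hjJ, hJ⟩) (fun h => h ⟨J, hjJ, hiJ, hJ⟩)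
  simp only [Finset.coe_eq_empty] at hempty
  exact hempty.imp
    (fun h => isUnit_of_vars_eq_empty_of_dvd h ⟨q, hpq⟩ hspan)
    (fun h => isUnit_of_vars_eq_empty_of_dvd h ⟨p, hpq.trans (mul_comm p q)⟩ hspan)
end

section
/- Let A be an integral domain, I a finite set, and R = A[x_i : i ∈ I]. Let f ∈ R and let i, j ∈ I be distinct indices such that the degree of f in the variable x_i is exactly 1, the degree of f in the variable x_j is exactly 1, and no monomial in the support of f is divisible by x_i·x_j. Suppose f = g·h with g, h ∈ R and g does not involve the variable x_i (i.e., g ∈ A[x_k : k ≠ i]). Then g does not involve the variable x_j. -/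
open MvPolynomial

namespace MvPolynomial

variable {σ R : Type*} [CommRing R]

/-- The substitution `X k ↦ X k * T ^ w k`, which separates a polynomial into its weighted
homogeneous components. -/
noncomputable def weightSubst (w : σ → ℕ) :
    MvPolynomial σ R →ₐ[R] Polynomial (MvPolynomial σ R) :=
  aeval fun k => Polynomial.C (X k) * Polynomial.X ^ w k

theorem weightSubst_monomial (w : σ → ℕ) (d : σ →₀ ℕ) (c : R) :
    weightSubst w (monomial d c) =
      Polynomial.C (monomial d c) * Polynomial.X ^ Finsupp.weight w d := by
  have hC : algebraMap R (Polynomial (MvPolynomial σ R)) c = Polynomial.C (C c) := rfl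
  rw [weightSubst, aeval_monomial, hC, monomial_eq]
  simp only [mul_pow, Finsupp.prod, Finset.prod_mul_distrib, Finsupp.weight_apply, Finsupp.sum,
    map_mul, map_prod, map_pow, ← pow_mul, Finset.prod_pow_eq_pow_sum, smul_eq_mul,
    mul_comm (w _), mul_assoc]

theorem coeff_coeff_weightSubst (w : σ → ℕ) (p : MvPolynomial σ R) (n : ℕ) (d : σ →₀ ℕ) :
    coeff d ((weightSubst w p).coeff n) = if Finsupp.weight w d = n then coeff d p else 0 := by
  classical
  induction p using MvPolynomial.induction_on' with
  | monomial e c =>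
    rw [weightSubst_monomial, Polynomial.coeff_C_mul_X_pow]
    by_cases h : e = d
    · subst h
      split_ifs <;> simp_all
    · split_ifs <;> simp [coeff_monomial, h]
  | add p q hp hq =>
    rw [map_add, Polynomial.coeff_add, coeff_add, hp, hq, coeff_add]
    split_ifs <;> simp

theorem weightSubst_injective (w : σ → ℕ) :
    Function.Injective (weightSubst w : MvPolynomial σ R → _) := by
  refine (injective_iff_map_eq_zero _).2 fun p hp => ?_
  ext d
  simpa [hp] using (coeff_coeff_weightSubst w p (Finsupp.weight w d) d).symm

theorem natDegree_weightSubst (w : σ → ℕ) (p : MvPolynomial σ R) :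
    (weightSubst w p).natDegree = weightedTotalDegree w p := by
  apply le_antisymm
  · refine Polynomial.natDegree_le_iff_coeff_eq_zero.2 fun n hn => ?_
    ext d
    rw [coeff_coeff_weightSubst, coeff_zero, ite_eq_right_iff]
    intro hd
    by_contra hp
    have := le_weightedTotalDegree w (mem_support_iff.2 hp)
    omega
  · refine Finset.sup_le fun d hd => Polynomial.le_natDegree_of_ne_zero fun h => ?_
    have := coeff_coeff_weightSubst w p (Finsupp.weight w d) d
    simp_all

theorem weightedTotalDegree_mul_of_isDomain [IsDomain R] (w : σ → ℕ) {p q : MvPolynomial σ R}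
    (hp : p ≠ 0) (hq : q ≠ 0) :
    weightedTotalDegree w (p * q) = weightedTotalDegree w p + weightedTotalDegree w q := by
  simp only [← natDegree_weightSubst, map_mul]
  exact Polynomial.natDegree_mul
    ((map_ne_zero_iff _ (weightSubst_injective w)).2 hp)
    ((map_ne_zero_iff _ (weightSubst_injective w)).2 hq)

end MvPolynomial

/-- Let `A` be an integral domain, `I` a finite set, `R = A[x_i : i ∈ I]`.
Let `f ∈ R`, and `i ≠ j` in `I` such that `deg_{x_i} f = 1`, `deg_{x_j} f = 1`, and no
monomial in the support of `f` is divisible by `x_i · x_j`. If `f = g·h` and `g` does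
not involve `x_i`, then `g` does not involve `x_j`. -/
theorem stmt1 (A : Type*) [CommRing A] [IsDomain A]
    (I : Type*) [Fintype I] [DecidableEq I]
    (f g h : MvPolynomial I A)
    (i j : I) (hij : i ≠ j)
    (hdi : f.degreeOf i = 1) (hdj : f.degreeOf j = 1)
    (hnm : ∀ m ∈ f.support, m i = 0 ∨ m j = 0)
    (hfgh : f = g * h)
    (hgi : i ∉ g.vars) :
    j ∉ g.vars := by
  have hf : f ≠ 0 := by
    rintro rfl
    simp at hdi
  have hg : g ≠ 0 := left_ne_zero_of_mul (hfgh ▸ hf)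
  have hh : h ≠ 0 := right_ne_zero_of_mul (hfgh ▸ hf)
  set w : I → ℕ := Pi.single i 1 + Pi.single j 1
  have hw (d : I →₀ ℕ) : Finsupp.weight w d = d i + d j := by
    simp [w, Finsupp.weight_apply, Finsupp.sum_fintype, mul_add, Finset.sum_add_distrib,
      Pi.single_apply]
  have hwf : weightedTotalDegree w f ≤ 1 := by
    refine Finset.sup_le fun d hd => ?_
    have h1 := degreeOf_le_iff.1 hdi.le d hd
    have h2 := degreeOf_le_iff.1 hdj.le d hd
    have h3 := hnm d hd
    rw [hw]
    omega
  have hdh : h.degreeOf i = 1 := by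
    rw [hfgh, degreeOf_mul_eq hg hh] at hdi
    have hg0 : g.degreeOf i = 0 := by
      rwa [degreeOf_def, Multiset.count_eq_zero, ← Multiset.mem_toFinset, ← vars_def]
    omega
  have hwh : 1 ≤ weightedTotalDegree w h := by
    rw [← hdh, degreeOf_le_iff]
    intro d hd
    have := le_weightedTotalDegree w hd
    rw [hw] at this
    omega
  rw [hfgh, weightedTotalDegree_mul_of_isDomain w hg hh] at hwf
  rw [mem_vars_iff_mem_support]
  rintro ⟨d, hd, hjd⟩
  have := le_weightedTotalDegree w hd
  rw [hw] at this
  have := Finsupp.mem_support_iff.1 hjd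
  omega
end

section
/- Let F be a field, and let A be an n₁ × n₂ matrix whose entries are polynomials in k variables over F, each of total degree at most d. Let r be the rank of A regarded as a matrix over the field of fractions of the polynomial ring F[x₁, …, x_k]. Then: (a) for every point y ∈ F^k, the rank of the scalar matrix A(y) obtained by evaluating all entries at y is at most r; (b) for every finite subset S ⊆ F of cardinality s, the number of tuples y ∈ S^k for which the rank of A(y) is strictly less than r is at most d·r·s^{k−1}. -/
open MvPolynomial
open scoped Classical

/-- A matrix of rank `r` over a field has `r` linearly independent rows. -/
theorem Matrix.exists_submatrix_linearIndependent_row {K m n : Type*} [Field K] [Finite m]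
    [Fintype n] (M : Matrix m n K) {r : ℕ} (hr : M.rank = r) :
    ∃ f : Fin r → m, LinearIndependent K (M.submatrix f id).row := by
  subst hr
  rw [M.rank_eq_finrank_span_row]
  obtain ⟨v, hv, -, hli⟩ := Submodule.exists_fun_fin_finrank_span_eq K (Set.range M.row)
  choose f hf using hv
  obtain rfl : (fun i => M.row (f i)) = v := funext hf
  exact ⟨f, hli⟩

/-- A matrix over a field has a nonsingular square submatrix whose size is its rank. -/
theorem Matrix.exists_submatrix_det_ne_zero {K m n : Type*} [Field K] [Fintype m] [Fintype n]
    (M : Matrix m n K) :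
    ∃ (f : Fin M.rank → m) (g : Fin M.rank → n), (M.submatrix f g).det ≠ 0 := by
  obtain ⟨f, hf⟩ := M.exists_submatrix_linearIndependent_row rfl
  have hrank : (Matrix.transpose (M.submatrix f id)).rank = M.rank := by
    rw [Matrix.rank_transpose, hf.rank_matrix, Fintype.card_fin]
  obtain ⟨g, hg⟩ :=
    (Matrix.transpose (M.submatrix f id)).exists_submatrix_linearIndependent_row hrank
  refine ⟨f, g, ?_⟩
  have h := Matrix.linearIndependent_rows_iff_isUnit.mp hg
  rw [Matrix.isUnit_iff_isUnit_det] at h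
  rw [← Matrix.det_transpose]
  exact h.ne_zero

/-- A matrix over a field with a nonsingular square submatrix of size `r` has rank at least `r`. -/
theorem Matrix.le_rank_of_submatrix_det_ne_zero {K m n : Type*} [Field K] [Fintype n]
    (M : Matrix m n K) {r : ℕ} (f : Fin r → m) (g : Fin r → n)
    (h : (M.submatrix f g).det ≠ 0) : r ≤ M.rank := by
  have hr := Matrix.rank_of_det_ne_zero h
  rw [Fintype.card_fin] at hr
  exact hr.symm.trans_le (M.rank_submatrix_le f g)

/-- The determinant of a matrix of polynomials of total degree at most `d` has total degree at most
`d` times the size of the matrix. -/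
theorem Matrix.totalDegree_det_le {R σ ι : Type*} [CommRing R] [Fintype ι] [DecidableEq ι]
    (M : Matrix ι ι (MvPolynomial σ R)) {d : ℕ} (h : ∀ i j, (M i j).totalDegree ≤ d) :
    M.det.totalDegree ≤ d * Fintype.card ι := by
  rw [Matrix.det_apply]
  refine totalDegree_finsetSum_le fun τ _ => ?_
  rw [Units.smul_def]
  refine (totalDegree_smul_le _ _).trans ((totalDegree_finsetProd _ _).trans ?_)
  refine (Finset.sum_le_card_nsmul _ _ d fun i _ => h _ _).trans ?_
  simp [mul_comm]

/-- The **Schwartz-Zippel lemma** as a bound on the number of zeros in a cube. -/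
theorem MvPolynomial.card_filter_eval_eq_zero_le {R : Type*} [CommRing R] [IsDomain R] {k : ℕ}
    {p : MvPolynomial (Fin k) R} (hp : p ≠ 0) (S : Finset R) :
    ((Fintype.piFinset fun _ : Fin k => S).filter fun y => eval y p = 0).card
      ≤ p.totalDegree * S.card ^ (k - 1) := by
  have h := schwartz_zippel_totalDegree hp S
  obtain rfl | hS := S.eq_empty_or_nonempty
  · cases k <;> simp_all [Finset.filter_singleton]
  have hs : (0 : ℚ≥0) < S.card := by exact_mod_cast hS.card_pos
  rw [div_le_div_iff₀ (by positivity) hs] at h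
  norm_cast at h
  cases k with
  | zero => simpa using (Nat.le_mul_of_pos_right _ hS.card_pos).trans h
  | succ k =>
    refine Nat.le_of_mul_le_mul_right (h.trans_eq ?_) hS.card_pos
    rw [Nat.add_sub_cancel, pow_succ, mul_assoc]

/-- Let `F` be a field and `A` an `n₁ × n₂` matrix with entries in
`F[x₁,…,x_k]`, each entry of total degree at most `d`. Let `r` be the rank of `A`
over the fraction field of `F[x₁,…,x_k]`. Then (a) for every `y ∈ F^k` the rank of
the evaluated matrix `A(y)` is at most `r`; (b) for every finite `S ⊆ F` of
cardinality `s`, the number of `y ∈ S^k` with `rank A(y) < r` is at most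
`d·r·s^(k−1)`. -/
theorem stmt2 (F : Type*) [Field F] (k n₁ n₂ d : ℕ)
    (A : Matrix (Fin n₁) (Fin n₂) (MvPolynomial (Fin k) F))
    (hdeg : ∀ i j, (A i j).totalDegree ≤ d)
    (r : ℕ)
    (hr : r = (A.map (fun p => algebraMap (MvPolynomial (Fin k) F)
        (FractionRing (MvPolynomial (Fin k) F)) p)).rank) :
    (∀ y : Fin k → F, (A.map (fun p => MvPolynomial.eval y p)).rank ≤ r) ∧
    (∀ S : Finset F,
      ((Fintype.piFinset (fun _ : Fin k => S)).filter
        (fun y => (A.map (fun p => MvPolynomial.eval y p)).rank < r)).card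
        ≤ d * r * S.card ^ (k - 1)) := by
  have hminor : ∀ {r : ℕ} (y : Fin k → F) (f : Fin r → Fin n₁) (g : Fin r → Fin n₂),
      ((A.map (fun p => eval y p)).submatrix f g).det = eval y (A.submatrix f g).det :=
    fun y f g => ((eval y).map_det (A.submatrix f g)).symm
  have hminor' : ∀ {r : ℕ} (f : Fin r → Fin n₁) (g : Fin r → Fin n₂),
      ((A.map (fun p => algebraMap (MvPolynomial (Fin k) F)
        (FractionRing (MvPolynomial (Fin k) F)) p)).submatrix f g).det =
      algebraMap (MvPolynomial (Fin k) F) (FractionRing (MvPolynomial (Fin k) F))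
        (A.submatrix f g).det :=
    fun f g => ((algebraMap (MvPolynomial (Fin k) F)
      (FractionRing (MvPolynomial (Fin k) F))).map_det (A.submatrix f g)).symm
  refine ⟨fun y => ?_, fun S => ?_⟩
  · obtain ⟨f, g, h⟩ := (A.map (fun p => eval y p)).exists_submatrix_det_ne_zero
    rw [hr]
    refine Matrix.le_rank_of_submatrix_det_ne_zero _ f g ?_
    rw [hminor] at h
    rw [hminor', Ne, FaithfulSMul.algebraMap_eq_zero_iff]
    intro h0
    simp [h0] at h
  · obtain ⟨f, g, h⟩ : ∃ (f : Fin r → Fin n₁) (g : Fin r → Fin n₂),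
        (A.submatrix f g).det ≠ 0 := by
      subst hr
      obtain ⟨f, g, h⟩ := (A.map (fun p => algebraMap (MvPolynomial (Fin k) F)
        (FractionRing (MvPolynomial (Fin k) F)) p)).exists_submatrix_det_ne_zero
      refine ⟨f, g, fun h0 => h ?_⟩
      rw [hminor', h0, map_zero]
    have hdet : (A.submatrix f g).det.totalDegree ≤ d * r := by
      simpa using (A.submatrix f g).totalDegree_det_le fun i j => hdeg (f i) (g j)
    refine (Finset.card_le_card (Finset.monotone_filter_right _ fun y _ hy => ?_)).trans
      ((card_filter_eval_eq_zero_le h S).trans (Nat.mul_le_mul_right _ hdet))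
    by_contra hne
    rw [← hminor] at hne
    exact hy.not_ge (Matrix.le_rank_of_submatrix_det_ne_zero _ f g hne)
end

section
/- Let R be a ring and z an R-module. An R-module y is z-saturated if and only if Hom_R(t, y) = 0 for every z-reduced R-module t. -/
universe u

/-- Let `R` be a ring and `z` an `R`-module. An `R`-module `y` is
`z`-saturated (every nonzero submodule of `y` has a nonzero hom to `z`) if and only if
`Hom_R(t, y) = 0` for every `z`-reduced `R`-module `t` (i.e. every `t` with
`Hom_R(t, z) = 0`). -/
theorem stmt7 (R : Type u) [Ring R]
    (Z : Type u) [AddCommGroup Z] [Module R Z]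
    (Y : Type u) [AddCommGroup Y] [Module R Y] :
    (∀ y' : Submodule R Y, y' ≠ ⊥ → ∃ f : y' →ₗ[R] Z, f ≠ 0) ↔
    (∀ (T : Type u) [AddCommGroup T] [Module R T],
       (∀ f : T →ₗ[R] Z, f = 0) → ∀ g : T →ₗ[R] Y, g = 0) := by
  constructor
  · intro hY T _ _ hT g
    by_contra hg
    obtain ⟨f, hf⟩ := hY (LinearMap.range g) (mt LinearMap.range_eq_bot.mp hg)
    refine hf (LinearMap.ext fun y => ?_)
    obtain ⟨t, rfl⟩ := g.surjective_rangeRestrict y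
    exact LinearMap.congr_fun (hT (f.comp g.rangeRestrict)) t
  · intro hY y' hy'
    by_contra! hf
    exact hy' (by simpa using congrArg LinearMap.range (hY y' hf y'.subtype))
end

section
/- Let Δ_1, …, Δ_k (k ≥ 1) be segments forming a balanced multisegment, indexed so that b(Δ_1) > … > b(Δ_k). Let m be the largest index in {1, …, k} such that e(Δ_1) > … > e(Δ_m), and let l be the smallest index with 1 ≤ l ≤ m such that Δ_{i+1} ≺ Δ_i for all l ≤ i < m. Assume that there do not exist indices i, j with l ≤ i < m < j ≤ k and e(Δ_{i+1}) < e(Δ_j) < e(Δ_i). Let Δ' be a segment with Δ' ⊆ Δ_l and e(Δ') = e(Δ_l), and let ⁺Δ' denote the shifted segment [b(Δ')+1, e(Δ')+1]. Set X = { j ∈ {1, …, k} : Δ_j ≺ Δ' } and Y = { i ∈ {1, …, k} : Δ_i ≺ ⁺Δ' }. Then for every j ∈ X the set { i ∈ Y : Δ_j ≺ Δ_i } is nonempty, every element i of this set satisfies l ≤ i < j, and the map f : X → Y defined by f(j) = max { i ∈ Y : Δ_j ≺ Δ_i } is injective. -/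
/-- A segment is an interval `[a, b]` of integers with `a ≤ b`, encoded as the pair
`(a, b) : ℤ × ℤ`; `b(Δ) = Δ.1` and `e(Δ) = Δ.2`.  `SegPrec Δ Γ` is Zelevinsky's
precedence relation `Δ ≺ Γ`: for `Δ = [a,b]`, `Γ = [c,d]`, `a+1 ≤ c ≤ b+1 ≤ d`. -/
def SegPrec (Δ Γ : ℤ × ℤ) : Prop :=
  Δ.1 + 1 ≤ Γ.1 ∧ Γ.1 ≤ Δ.2 + 1 ∧ Δ.2 + 1 ≤ Γ.2

/-- A multisegment (finite multiset of segments) is regular if the left endpoints are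
pairwise distinct and the right endpoints are pairwise distinct. -/
def MSRegular (m : Multiset (ℤ × ℤ)) : Prop :=
  (m.map Prod.fst).Nodup ∧ (m.map Prod.snd).Nodup

/-- An enumeration `Γ 0, …, Γ (n-1)` (corresponding to `Δ_1, …, Δ_n` in 1-based
notation) is of type 4231 if `n ≥ 4`, `Δ_i ≺ Δ_{i−1}` for `i = 3, …, n`,
`b(Δ_n) < b(Δ_1) < b(Δ_{n−1})`, and `e(Δ_3) < e(Δ_1) < e(Δ_2)`. -/
def Type4231 (n : ℕ) (Γ : ℕ → ℤ × ℤ) : Prop :=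
  4 ≤ n ∧ (∀ i, 2 ≤ i → i < n → SegPrec (Γ i) (Γ (i - 1))) ∧
  (Γ (n - 1)).1 < (Γ 0).1 ∧ (Γ 0).1 < (Γ (n - 2)).1 ∧
  (Γ 2).2 < (Γ 0).2 ∧ (Γ 0).2 < (Γ 1).2

/-- An enumeration `Γ 0, …, Γ (n-1)` (i.e. `Δ_1, …, Δ_n` in 1-based notation) is of
type 3412 if `n ≥ 4`, `Δ_i ≺ Δ_{i−1}` for `i = 4, …, n` and `Δ_2 ≺ Δ_1`,
`b(Δ_2) < b(Δ_n) < b(Δ_1) < b(Δ_{n−1})`, and `e(Δ_4) < e(Δ_2) < e(Δ_3) < e(Δ_1)`. -/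
def Type3412 (n : ℕ) (Γ : ℕ → ℤ × ℤ) : Prop :=
  4 ≤ n ∧ (∀ i, 3 ≤ i → i < n → SegPrec (Γ i) (Γ (i - 1))) ∧ SegPrec (Γ 1) (Γ 0) ∧
  (Γ 1).1 < (Γ (n - 1)).1 ∧ (Γ (n - 1)).1 < (Γ 0).1 ∧ (Γ 0).1 < (Γ (n - 2)).1 ∧
  (Γ 3).2 < (Γ 1).2 ∧ (Γ 1).2 < (Γ 2).2 ∧ (Γ 2).2 < (Γ 0).2

/-- `m` admits a submultisegment that can be written (i.e. enumerated) so as to be of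
type `T`. -/
def HasSubOfType (T : ℕ → (ℕ → ℤ × ℤ) → Prop) (m : Multiset (ℤ × ℤ)) : Prop :=
  ∃ (n : ℕ) (Γ : ℕ → ℤ × ℤ), T n Γ ∧
    ((((List.range n).map Γ) : List (ℤ × ℤ)) : Multiset (ℤ × ℤ)) ≤ m

/-- A regular multisegment is balanced if it admits no submultisegment of type 4231
or of type 3412. -/
def MSBalanced (m : Multiset (ℤ × ℤ)) : Prop :=
  MSRegular m ∧ ¬ HasSubOfType Type4231 m ∧ ¬ HasSubOfType Type3412 m

/-- Four segments of a family, taken at distinct indices, cannot form a multisegment of type 3412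
if the family admits none. -/
theorem not_type3412_of_indices {k : ℕ} {seg : ℕ → ℤ × ℤ}
    (h : ¬ HasSubOfType Type3412 (((List.range k).map seg : List (ℤ × ℤ)) : Multiset (ℤ × ℤ)))
    {p q r s : ℕ} (hnd : [p, q, r, s].Nodup) (hlt : ∀ x ∈ [p, q, r, s], x < k)
    (hsr : SegPrec (seg s) (seg r)) (hqp : SegPrec (seg q) (seg p))
    (hb₁ : (seg q).1 < (seg s).1) (hb₂ : (seg s).1 < (seg p).1) (hb₃ : (seg p).1 < (seg r).1)
    (he₁ : (seg s).2 < (seg q).2) (he₂ : (seg q).2 < (seg r).2) (he₃ : (seg r).2 < (seg p).2) :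
    False := by
  refine h ⟨4, fun n => seg ([p, q, r, s].getD n 0), ⟨le_rfl, ?_, hqp, hb₁, hb₂, hb₃, he₁, he₂, he₃⟩,
    ?_⟩
  · intro i hi hi'
    obtain rfl : i = 3 := by omega
    exact hsr
  · have hle : (([p, q, r, s] : List ℕ) : Multiset ℕ) ≤ ((List.range k : List ℕ) : Multiset ℕ) :=
      (Multiset.le_iff_subset (Multiset.coe_nodup.2 hnd)).2 fun x hx =>
        Multiset.mem_coe.2 (List.mem_range.2 (hlt x (Multiset.mem_coe.1 hx)))
    exact Multiset.map_le_map hle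

/-- In a regular indexed multisegment, the right endpoints at distinct indices differ. -/
theorem MSRegular.snd_ne {k : ℕ} {seg : ℕ → ℤ × ℤ}
    (h : MSRegular (((List.range k).map seg : List (ℤ × ℤ)) : Multiset (ℤ × ℤ)))
    {i j : ℕ} (hi : i < k) (hj : j < k) (hij : i ≠ j) : (seg i).2 ≠ (seg j).2 := by
  have hnd := h.2
  rw [Multiset.map_coe, Multiset.coe_nodup, List.map_map] at hnd
  exact fun he => hij
    (List.inj_on_of_nodup_map hnd (List.mem_range.2 hi) (List.mem_range.2 hj) he)

/-- If a finite sequence `e` decreases on `[l, m]` and `x` avoids every gap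
between consecutive terms and every term, then `x` below `e l` lies below `e m`. -/
theorem lt_last_of_lt_first {e : ℕ → ℤ} {x : ℤ} {l m : ℕ} (hlm : l ≤ m)
    (hgap : ∀ i, l ≤ i → i < m → ¬ (e (i + 1) < x ∧ x < e i))
    (hne : ∀ i, l ≤ i → i ≤ m → e i ≠ x) (hx : x < e l) : x < e m := by
  induction m, hlm using Nat.le_induction with
  | base => exact hx
  | succ n hn ih =>
    have hxn := ih (fun i h₁ h₂ => hgap i h₁ (by omega)) fun i h₁ h₂ => hne i h₁ (by omega)
    have h₁ := hgap n hn (by omega)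
    have h₂ := hne (n + 1) (by omega) le_rfl
    grind

/-- Let `Δ_1, …, Δ_k` (`k ≥ 1`) be segments forming a balanced
multisegment with `b(Δ_1) > … > b(Δ_k)`.  (Here `seg i` encodes `Δ_{i+1}`, i.e.
`Δ_j = seg (j-1)` for the 1-based paper index `j`.)  Let `m` be the largest index with
`e(Δ_1) > … > e(Δ_m)` and `l` the smallest index with `1 ≤ l ≤ m` such that
`Δ_{i+1} ≺ Δ_i` for all `l ≤ i < m`.  Assume there are no indices `i, j` with
`l ≤ i < m < j ≤ k` and `e(Δ_{i+1}) < e(Δ_j) < e(Δ_i)`.  Let `Δ' ⊆ Δ_l` be a segment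
with `e(Δ') = e(Δ_l)` and let `⁺Δ' = [b(Δ')+1, e(Δ')+1]`.  With
`X = {j ∈ {1,…,k} : Δ_j ≺ Δ'}` and `Y = {i ∈ {1,…,k} : Δ_i ≺ ⁺Δ'}`, then for every
`j ∈ X` the set `{i ∈ Y : Δ_j ≺ Δ_i}` is nonempty, each of its elements `i` satisfies
`l ≤ i < j`, and `f : X → Y`, `f(j) = max {i ∈ Y : Δ_j ≺ Δ_i}`, is injective. -/
theorem stmt8
    (k : ℕ) (hk : 1 ≤ k) (seg : ℕ → ℤ × ℤ)
    (hseg : ∀ i < k, (seg i).1 ≤ (seg i).2)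
    (hbal : MSBalanced (((List.range k).map seg : List (ℤ × ℤ)) : Multiset (ℤ × ℤ)))
    (hbdec : ∀ i j, i < j → j < k → (seg j).1 < (seg i).1)
    (m : ℕ) (hm1 : 1 ≤ m) (hmk : m ≤ k)
    (hmdec : ∀ i j, i < j → j < m → (seg j).2 < (seg i).2)
    (hmmax : ∀ m', m < m' → m' ≤ k →
      ¬ (∀ i j, i < j → j < m' → (seg j).2 < (seg i).2))
    (l : ℕ) (hl1 : 1 ≤ l) (hlm : l ≤ m)
    (hlprec : ∀ i, l ≤ i → i < m → SegPrec (seg i) (seg (i - 1)))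
    (hlmin : ∀ l', 1 ≤ l' → l' < l →
      ¬ (∀ i, l' ≤ i → i < m → SegPrec (seg i) (seg (i - 1))))
    (hno : ¬ ∃ i j, l ≤ i ∧ i < m ∧ m < j ∧ j ≤ k ∧
      (seg i).2 < (seg (j - 1)).2 ∧ (seg (j - 1)).2 < (seg (i - 1)).2)
    (Δ' : ℤ × ℤ) (hΔ'seg : Δ'.1 ≤ Δ'.2)
    (hΔ'sub : (seg (l - 1)).1 ≤ Δ'.1) (hΔ'e : Δ'.2 = (seg (l - 1)).2) :
    (∀ j, 1 ≤ j → j ≤ k → SegPrec (seg (j - 1)) Δ' →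
        ∃ i, (1 ≤ i ∧ i ≤ k ∧ SegPrec (seg (i - 1)) (Δ'.1 + 1, Δ'.2 + 1)) ∧
          SegPrec (seg (j - 1)) (seg (i - 1))) ∧
    (∀ j, 1 ≤ j → j ≤ k → SegPrec (seg (j - 1)) Δ' →
      ∀ i, (1 ≤ i ∧ i ≤ k ∧ SegPrec (seg (i - 1)) (Δ'.1 + 1, Δ'.2 + 1)) →
        SegPrec (seg (j - 1)) (seg (i - 1)) → l ≤ i ∧ i < j) ∧
    (∀ j j' fi fi',
      1 ≤ j → j ≤ k → SegPrec (seg (j - 1)) Δ' →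
      1 ≤ j' → j' ≤ k → SegPrec (seg (j' - 1)) Δ' →
      IsGreatest {i | (1 ≤ i ∧ i ≤ k ∧ SegPrec (seg (i - 1)) (Δ'.1 + 1, Δ'.2 + 1)) ∧
        SegPrec (seg (j - 1)) (seg (i - 1))} fi →
      IsGreatest {i | (1 ≤ i ∧ i ≤ k ∧ SegPrec (seg (i - 1)) (Δ'.1 + 1, Δ'.2 + 1)) ∧
        SegPrec (seg (j' - 1)) (seg (i - 1))} fi' →
      fi = fi' → j = j') := by
  have hreg := hbal.1
  have hord : ∀ {i j : ℕ}, i < k → j < k → (seg j).1 < (seg i).1 → i < j := by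
    intro i j hi hj h
    by_contra! hji
    rcases hji.eq_or_lt with rfl | hlt
    · exact h.false
    · exact (h.trans (hbdec j i hlt hi)).false
  have hge : ∀ {i : ℕ}, (seg i).2 ≤ (seg (l - 1)).2 → l - 1 ≤ i := by
    intro i h
    by_contra! hi
    have := hmdec i (l - 1) hi (by omega)
    omega
  have hlt : ∀ {i : ℕ}, (seg i).2 < (seg (l - 1)).2 → l - 1 < i := fun {i} h =>
    lt_of_le_of_ne (hge h.le) fun h' => by simp [h'] at h
  refine ⟨?_, ?_, ?_⟩
  · rintro j hj1 hjk ⟨h₁, h₂, h₃⟩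
    have hlj : l - 1 < j - 1 := hlt (by omega)
    have hb := hbdec _ _ hlj (by omega)
    refine ⟨l, ⟨hl1, by omega, ?_, ?_, ?_⟩, ?_, ?_, ?_⟩
    all_goals try dsimp only
    all_goals omega
  · rintro j hj1 hjk - i ⟨hi1, hik, -, -, hi⟩ ⟨h, -, -⟩
    dsimp only at hi
    have := hge (i := i - 1) (by omega)
    have := hord (i := i - 1) (j := j - 1) (by omega) (by omega) (by omega)
    omega
  · -- Two elements `j < j'` of a fibre are nested, and `m + 1, j', m, j` is of type 3412.
    have key : ∀ j j' f, 1 ≤ j → j' ≤ k → SegPrec (seg (j - 1)) Δ' →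
        SegPrec (seg (j' - 1)) Δ' →
        SegPrec (seg (j - 1)) (seg (f - 1)) → 1 ≤ f → f ≤ k →
        (∀ i, 1 ≤ i → i ≤ k → SegPrec (seg (i - 1)) (Δ'.1 + 1, Δ'.2 + 1) →
          SegPrec (seg (j' - 1)) (seg (i - 1)) → i ≤ f) → ¬ j < j' := by
      rintro j j' f hj hj'k ⟨h₁, h₂, h₃⟩ ⟨h₁', h₂', h₃'⟩ ⟨hjf, -, -⟩ hf1 hfk hmax hjj'
      have hb := hbdec (j - 1) (j' - 1) (by omega) (by omega)
      have hfj := hord (i := f - 1) (j := j - 1) (by omega) (by omega) (by omega)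
      have hne := hreg.snd_ne (i := j - 1) (j := j' - 1) (by omega) (by omega) (by omega)
      have hnest : (seg (j - 1)).2 < (seg (j' - 1)).2 := by
        by_contra! hle
        have := hmax j hj (by omega)
          (by refine ⟨?_, ?_, ?_⟩ <;> dsimp only <;> omega)
          (by refine ⟨?_, ?_, ?_⟩ <;> omega)
        omega
      have hmj' : m < j' := by
        by_contra! h
        have := hmdec (j - 1) (j' - 1) (by omega) (by omega)
        omega
      have hj'm : (seg (j' - 1)).2 < (seg (m - 1)).2 := by
        refine lt_last_of_lt_first (e := fun i => (seg i).2) (l := l - 1) (by omega) ?_ ?_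
          (by omega)
        · rintro i hi him ⟨ha, hb⟩
          exact hno ⟨i + 1, j', by omega, by omega, hmj', hj'k, ha, hb⟩
        · exact fun i hi him => hreg.snd_ne (by omega) (by omega) (by omega)
      have hmj : m < j := by
        by_contra! h
        rcases h.eq_or_lt with rfl | h
        · omega
        · have := hmdec (j - 1) (m - 1) (by omega) (by omega)
          omega
      have hpm : (seg (m - 1)).2 < (seg m).2 := by
        by_contra! hle
        refine hmmax (m + 1) (by omega) (by omega) fun i i' hii' hi' => ?_
        rcases (Nat.le_of_lt_succ hi').eq_or_lt with rfl | h
        · have hlast := hreg.snd_ne (i := i' - 1) (j := i') (by omega) (by omega) (by omega)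
          rcases (show i ≤ i' - 1 by omega).eq_or_lt with rfl | hi
          · omega
          · have := hmdec i (i' - 1) hi (by omega)
            omega
        · exact hmdec i i' hii' h
      have hjp : m ≠ j - 1 := by
        rintro h
        rw [← h] at hnest
        omega
      have hbp := hbdec (m - 1) m (by omega) (by omega)
      have hbj := hbdec m (j - 1) (by omega) (by omega)
      have hbm : (seg (m - 1)).1 ≤ (seg (l - 1)).1 := by
        rcases hlm.eq_or_lt with rfl | h
        · exact le_rfl
        · exact (hbdec (l - 1) (m - 1) (by omega) (by omega)).le
      refine not_type3412_of_indices hbal.2.2 (p := m) (q := j' - 1) (r := m - 1) (s := j - 1)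
        ?_ ?_ ⟨?_, ?_, ?_⟩ ⟨?_, ?_, ?_⟩ hb hbj hbp hnest hj'm hpm
      · simp only [List.nodup_cons, List.mem_cons, List.not_mem_nil, or_false, not_or,
          not_false_eq_true, List.nodup_nil, and_true]
        omega
      · simp only [List.mem_cons, List.not_mem_nil, or_false]
        omega
      all_goals omega
    rintro j j' f _ hj hjk hX hj' hj'k hX' ⟨⟨⟨hf1, hfk, -⟩, hjf⟩, hmax⟩ ⟨⟨-, hjf'⟩, hmax'⟩ rfl
    rcases lt_trichotomy j j' with h | h | h
    · exact absurd h (key j j' f hj hj'k hX hX' hjf hf1 hfk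
        fun i h₁ h₂ h₃ h₄ => hmax' ⟨⟨h₁, h₂, h₃⟩, h₄⟩)
    · exact h
    · exact absurd h (key j' j f hj' hjk hX' hX hjf' hf1 hfk
        fun i h₁ h₂ h₃ h₄ => hmax ⟨⟨h₁, h₂, h₃⟩, h₄⟩)
end

section
/- Let Δ_1, …, Δ_k (k ≥ 1) be segments forming a balanced multisegment, indexed so that b(Δ_1) > … > b(Δ_k). Let m be the largest index in {1, …, k} such that e(Δ_1) > … > e(Δ_m), and let l be the smallest index with 1 ≤ l ≤ m such that Δ_{i+1} ≺ Δ_i for all l ≤ i < m. Assume that there exist indices r, s with l ≤ r < m < s ≤ k and e(Δ_{r+1}) < e(Δ_s) < e(Δ_r). Then e(Δ_i) ≠ b(Δ_m) − 1 for every i ∈ {1, …, k}. -/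
theorem coe_map_range_comp_le {α : Type*} (f : ℕ → α) (idx : ℕ → ℕ) {n k : ℕ}
    (hlt : ∀ i < n, idx i < k)
    (hinj : ∀ i < n, ∀ j < n, idx i = idx j → i = j) :
    (((List.range n).map fun i => f (idx i) : List α) : Multiset α) ≤
      ((List.range k).map f : List α) := by
  have hnodup : ((List.range n).map idx).Nodup :=
    List.Nodup.map_on
      (fun i hi j hj h => hinj i (List.mem_range.1 hi) j (List.mem_range.1 hj) h)
      List.nodup_range
  have hsub : (List.range n).map idx ⊆ List.range k := by
    intro x hx
    obtain ⟨i, hi, rfl⟩ := List.mem_map.1 hx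
    exact List.mem_range.2 (hlt i (List.mem_range.1 hi))
  have hle : (((List.range n).map idx : List ℕ) : Multiset ℕ) ≤ (List.range k : List ℕ) :=
    hnodup.subperm hsub
  simpa [Function.comp_def] using Multiset.map_le_map (f := f) hle

section Chain

variable {k : ℕ} {seg : ℕ → ℤ × ℤ} {p q i : ℕ}

/-- A consecutive chain `seg i ≺ seg q ≺ ⋯ ≺ seg p` together with a segment `seg s` with
`b(seg i) < b(seg s) < b(seg q)` and `e(seg (p + 1)) < e(seg s) < e(seg p)` is of type 4231. -/
theorem hasSubOfType_type4231_of_chain {s : ℕ} (hpq : p < q)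
    (hprec : ∀ j, p < j → j ≤ q → SegPrec (seg j) (seg (j - 1)))
    (hi : SegPrec (seg i) (seg q)) (hqi : q < i) (hqs : q < s) (hik : i < k) (hsk : s < k)
    (hbi : (seg i).1 < (seg s).1) (hbq : (seg s).1 < (seg q).1)
    (hep : (seg (p + 1)).2 < (seg s).2) (hes : (seg s).2 < (seg p).2) :
    HasSubOfType Type4231 (((List.range k).map seg : List (ℤ × ℤ)) : Multiset (ℤ × ℤ)) := by
  have his : i ≠ s := by rintro rfl; exact hbi.false
  let idx : ℕ → ℕ := fun j => if j = 0 then s else if j ≤ q - p + 1 then p + (j - 1) else i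
  have h0 : idx 0 = s := rfl
  have hmid : ∀ j, 1 ≤ j → j ≤ q - p + 1 → idx j = p + (j - 1) := by
    intro j h1 h2
    simp only [idx]
    rw [if_neg (by omega), if_pos h2]
  have hlast : idx (q - p + 2) = i := by
    simp only [idx]
    rw [if_neg (by omega), if_neg (by omega)]
  refine ⟨q - p + 3, fun j => seg (idx j), ⟨by omega, ?_, ?_, ?_, ?_, ?_⟩,
    coe_map_range_comp_le seg idx ?_ ?_⟩
  · intro j h2 hj
    dsimp only
    rw [hmid (j - 1) (by omega) (by omega)]
    rcases eq_or_ne j (q - p + 2) with rfl | hne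
    · rw [hlast, show p + (q - p + 2 - 1 - 1) = q by omega]
      exact hi
    · rw [hmid j (by omega) (by omega), show p + (j - 1 - 1) = p + (j - 1) - 1 by omega]
      exact hprec (p + (j - 1)) (by omega) (by omega)
  · change (seg (idx (q - p + 2))).1 < (seg s).1
    rwa [hlast]
  · change (seg s).1 < (seg (idx (q - p + 1))).1
    rwa [hmid _ (by omega) (by omega), show p + (q - p + 1 - 1) = q by omega]
  · dsimp only
    rwa [hmid 2 (by omega) (by omega), h0]
  · dsimp only
    rwa [hmid 1 (by omega) (by omega), h0]
  · intro j hj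
    simp only [idx]
    split_ifs <;> omega
  · intro j hj j' hj'
    simp only [idx]
    split_ifs <;> omega

/-- A consecutive chain `seg i ≺ seg q ≺ ⋯ ≺ seg p` together with segments `seg s ≺ seg t`
with `b(seg s) < b(seg i) < b(seg t) < b(seg q)` and
`e(seg (p + 1)) < e(seg s) < e(seg p) < e(seg t)` is of type 3412. -/
theorem hasSubOfType_type3412_of_chain {s t : ℕ} (hpq : p < q)
    (hprec : ∀ j, p < j → j ≤ q → SegPrec (seg j) (seg (j - 1)))
    (hi : SegPrec (seg i) (seg q)) (hst : SegPrec (seg s) (seg t))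
    (hqi : q < i) (hqs : q < s) (hqt : q < t) (hik : i < k) (hsk : s < k) (htk : t < k)
    (hbs : (seg s).1 < (seg i).1) (hbi : (seg i).1 < (seg t).1)
    (hbt : (seg t).1 < (seg q).1) (hep : (seg (p + 1)).2 < (seg s).2)
    (hes : (seg s).2 < (seg p).2) (het : (seg p).2 < (seg t).2) :
    HasSubOfType Type3412 (((List.range k).map seg : List (ℤ × ℤ)) : Multiset (ℤ × ℤ)) := by
  have hsi : s ≠ i := by rintro rfl; exact hbs.false
  have hit : i ≠ t := by rintro rfl; exact hbi.false
  have hst' : s ≠ t := by rintro rfl; exact (hbs.trans hbi).false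
  let idx : ℕ → ℕ := fun j =>
    if j = 0 then t else if j = 1 then s else if j ≤ q - p + 2 then p + (j - 2) else i
  have h0 : idx 0 = t := rfl
  have h1 : idx 1 = s := rfl
  have hmid : ∀ j, 2 ≤ j → j ≤ q - p + 2 → idx j = p + (j - 2) := by
    intro j h1 h2
    simp only [idx]
    rw [if_neg (by omega), if_neg (by omega), if_pos h2]
  have hlast : idx (q - p + 3) = i := by
    simp only [idx]
    rw [if_neg (by omega), if_neg (by omega), if_neg (by omega)]
  refine ⟨q - p + 4, fun j => seg (idx j), ⟨by omega, ?_, hst, ?_, ?_, ?_, ?_, ?_, ?_⟩,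
    coe_map_range_comp_le seg idx ?_ ?_⟩
  · intro j h3 hj
    dsimp only
    rw [hmid (j - 1) (by omega) (by omega)]
    rcases eq_or_ne j (q - p + 3) with rfl | hne
    · rw [hlast, show p + (q - p + 3 - 1 - 2) = q by omega]
      exact hi
    · rw [hmid j (by omega) (by omega), show p + (j - 1 - 2) = p + (j - 2) - 1 by omega]
      exact hprec (p + (j - 2)) (by omega) (by omega)
  · change (seg s).1 < (seg (idx (q - p + 3))).1
    rwa [hlast]
  · change (seg (idx (q - p + 3))).1 < (seg t).1
    rwa [hlast]
  · change (seg t).1 < (seg (idx (q - p + 2))).1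
    rwa [hmid _ (by omega) (by omega), show p + (q - p + 2 - 2) = q by omega]
  · dsimp only
    rwa [hmid 3 (by omega) (by omega), h1]
  · dsimp only
    rwa [hmid 2 (by omega) (by omega), h1]
  · dsimp only
    rwa [hmid 2 (by omega) (by omega), h0]
  · intro j hj
    simp only [idx]
    split_ifs <;> omega
  · intro j hj j' hj'
    simp only [idx]
    split_ifs <;> omega

end Chain

/-- A value strictly between `f q` and `f p` and not attained by `f` on `[p, q]` is crossed
by some consecutive step. -/
theorem exists_succ_lt_and_lt {α : Type*} [LinearOrder α] (f : ℕ → α) {p q : ℕ} {x : α}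
    (hpq : p ≤ q) (hp : x < f p) (hq : f q < x) (hne : ∀ j, p ≤ j → j ≤ q → f j ≠ x) :
    ∃ j, p ≤ j ∧ j < q ∧ f (j + 1) < x ∧ x < f j := by
  induction q, hpq using Nat.le_induction with
  | base => exact absurd (hp.trans hq) (lt_irrefl _)
  | succ q hpq ih =>
    rcases lt_or_gt_of_ne (hne q hpq (by omega)) with h | h
    · obtain ⟨j, h1, h2, h3⟩ := ih h fun j h1 h2 => hne j h1 (by omega)
      exact ⟨j, h1, by omega, h3⟩
    · exact ⟨q, hpq, by omega, hq, h⟩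

/-- Let `Δ_1, …, Δ_k` (`k ≥ 1`) be segments forming a balanced
multisegment with `b(Δ_1) > … > b(Δ_k)`.  (Here `seg i` encodes `Δ_{i+1}`, i.e.
`Δ_j = seg (j-1)` for the 1-based paper index `j`.)  Let `m` be the largest index with
`e(Δ_1) > … > e(Δ_m)` and `l` the smallest index with `1 ≤ l ≤ m` such that
`Δ_{i+1} ≺ Δ_i` for all `l ≤ i < m`.  Assume there exist `r, s` with
`l ≤ r < m < s ≤ k` and `e(Δ_{r+1}) < e(Δ_s) < e(Δ_r)`.  Then
`e(Δ_i) ≠ b(Δ_m) − 1` for every `i ∈ {1,…,k}`. -/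
theorem stmt9
    (k : ℕ) (hk : 1 ≤ k) (seg : ℕ → ℤ × ℤ)
    (hseg : ∀ i < k, (seg i).1 ≤ (seg i).2)
    (hbal : MSBalanced (((List.range k).map seg : List (ℤ × ℤ)) : Multiset (ℤ × ℤ)))
    (hbdec : ∀ i j, i < j → j < k → (seg j).1 < (seg i).1)
    (m : ℕ) (hm1 : 1 ≤ m) (hmk : m ≤ k)
    (hmdec : ∀ i j, i < j → j < m → (seg j).2 < (seg i).2)
    (hmmax : ∀ m', m < m' → m' ≤ k →
      ¬ (∀ i j, i < j → j < m' → (seg j).2 < (seg i).2))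
    (l : ℕ) (hl1 : 1 ≤ l) (hlm : l ≤ m)
    (hlprec : ∀ i, l ≤ i → i < m → SegPrec (seg i) (seg (i - 1)))
    (hlmin : ∀ l', 1 ≤ l' → l' < l →
      ¬ (∀ i, l' ≤ i → i < m → SegPrec (seg i) (seg (i - 1))))
    (hex : ∃ r s, l ≤ r ∧ r < m ∧ m < s ∧ s ≤ k ∧
      (seg r).2 < (seg (s - 1)).2 ∧ (seg (s - 1)).2 < (seg (r - 1)).2) :
    ∀ i, 1 ≤ i → i ≤ k → (seg (i - 1)).2 ≠ (seg (m - 1)).1 - 1 := by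
  obtain ⟨r, s, hlr, hrm, hms, hsk, her, hes⟩ := hex
  obtain ⟨⟨-, hnodup⟩, h4231, h3412⟩ := hbal
  obtain ⟨p, rfl⟩ : ∃ p, r = p + 1 := ⟨r - 1, by omega⟩
  obtain ⟨q, rfl⟩ : ∃ q, m = q + 1 := ⟨m - 1, by omega⟩
  obtain ⟨s, rfl⟩ : ∃ s', s = s' + 1 := ⟨s - 1, by omega⟩
  rintro i hi1 hik heq
  obtain ⟨i, rfl⟩ : ∃ i', i = i' + 1 := ⟨i - 1, by omega⟩
  simp only [Nat.add_sub_cancel] at her hes heq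
  have heinj : ∀ a < k, ∀ b < k, (seg a).2 = (seg b).2 → a = b := by
    intro a ha b hb hab
    simp only [Multiset.map_coe, List.map_map, Multiset.coe_nodup] at hnodup
    exact List.inj_on_of_nodup_map hnodup (List.mem_range.2 ha) (List.mem_range.2 hb) hab
  have hbi := hseg i (by omega)
  have hbq := hseg q (by omega)
  have hqi : q < i := by
    by_contra! h
    rcases h.eq_or_lt with rfl | h
    · omega
    · have := hbdec i q h (by omega)
      omega
  have hprec_i : SegPrec (seg i) (seg q) := ⟨by omega, by omega, by omega⟩
  have hprec : ∀ j, p < j → j ≤ q → SegPrec (seg j) (seg (j - 1)) :=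
    fun j h1 h2 => hlprec j (by omega) (by omega)
  have heqs : (seg q).2 < (seg s).2 := by
    rcases (show p + 1 ≤ q by omega).eq_or_lt with rfl | h
    · exact her
    · exact (hmdec (p + 1) q h (by omega)).trans her
  have hbs := hbdec q s (by omega) (by omega)
  -- Otherwise `seg s` completes the chain to a configuration of type 4231.
  have his : i < s := by
    by_contra! h
    rcases h.eq_or_lt with rfl | h
    · omega
    · exact h4231 (hasSubOfType_type4231_of_chain (by omega) hprec hprec_i hqi (by omega)
        (by omega) (by omega) (hbdec s i h (by omega)) hbs her hes)
  have heqt : (seg q).2 < (seg (q + 1)).2 := by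
    by_contra! h
    have hlt : (seg (q + 1)).2 < (seg q).2 := lt_of_le_of_ne h fun h' => by
      have := heinj _ (by omega) _ (by omega) h'
      omega
    refine hmmax (q + 2) (by omega) (by omega) fun a b hab hb => ?_
    rcases (show b ≤ q + 1 by omega).eq_or_lt with rfl | hb'
    · rcases (show a ≤ q by omega).eq_or_lt with rfl | ha
      · exact hlt
      · exact hlt.trans (hmdec a q ha (by omega))
    · exact hmdec a b hab hb'
  have hit : q + 1 < i := by
    rcases (show q + 1 ≤ i by omega).eq_or_lt with rfl | h
    · omega
    · exact h
  have hbit := hbdec (q + 1) i hit (by omega)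
  have hbtq := hbdec q (q + 1) (by omega) (by omega)
  have hbsi := hbdec i s his (by omega)
  rcases lt_trichotomy (seg p).2 (seg (q + 1)).2 with h | h | h
  · exact h3412 (hasSubOfType_type3412_of_chain (by omega) hprec hprec_i
      ⟨by omega, by omega, by omega⟩ hqi (by omega) (by omega) (by omega) (by omega)
      (by omega) hbsi hbit hbtq her hes h)
  · have := heinj _ (by omega) _ (by omega) h
    omega
  · obtain ⟨j, hpj, hjq, h1, h2⟩ := exists_succ_lt_and_lt (fun j => (seg j).2)
      (show p ≤ q by omega) h heqt fun j _ hjq hj => by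
        have := heinj _ (by omega) _ (by omega) hj
        omega
    exact h4231 (hasSubOfType_type4231_of_chain hjq (fun a ha => hprec a (by omega)) hprec_i
      hqi (by omega) (by omega) (by omega) hbit hbtq h1 h2)
end

section
/- Let Δ_1, …, Δ_k (k ≥ 1) be segments forming a balanced multisegment, indexed so that b(Δ_1) > … > b(Δ_k). Let m be the largest index in {1, …, k} such that e(Δ_1) > … > e(Δ_m), and let l' be the smallest index with 1 ≤ l' ≤ m such that b(Δ_i) = b(Δ_{i+1}) + 1 for all l' ≤ i < m. For each index i define Δ'_i as follows: if l' ≤ i ≤ m, let Δ'_i be the truncated interval [b(Δ_i)+1, e(Δ_i)] (a genuine segment precisely when b(Δ_i) < e(Δ_i), and empty when b(Δ_i) = e(Δ_i)); otherwise let Δ'_i = Δ_i. Then the multisegment 𝔪' formed by the nonempty segments Δ'_i (discarding the empty ones) is regular and balanced. -/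
/-- An enumeration of a submultisegment of `Δ' 0 + … + Δ' (k-1)` (possibly with some segments
discarded) transfers to an enumeration of a submultisegment of `Δ 0 + … + Δ (k-1)`, as long as
all segments occurring are distinct. -/
theorem exists_index_of_map_range_le_filter {α : Type*} {k n : ℕ} {s s' Γ : ℕ → α}
    {p : α → Prop} [DecidablePred p]
    (hs : Set.InjOn s {i | i < k}) (hs' : Set.InjOn s' {i | i < k})
    (hle : (((List.range n).map Γ : List α) : Multiset α) ≤
      Multiset.filter p (((List.range k).map s' : List α) : Multiset α)) :
    ∃ σ : ℕ → ℕ, (∀ i < n, σ i < k ∧ s' (σ i) = Γ i) ∧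
      (((List.range n).map (fun i => s (σ i)) : List α) : Multiset α) ≤
        (((List.range k).map s : List α) : Multiset α) := by
  have hle' := hle.trans (Multiset.filter_le _ _)
  have hmem : ∀ i, ∃ j, i < n → j < k ∧ s' j = Γ i := by
    intro i
    by_cases hi : i < n
    · have h : Γ i ∈ (((List.range k).map s' : List α) : Multiset α) :=
        Multiset.mem_of_le hle' (by simpa using ⟨i, hi, rfl⟩)
      obtain ⟨j, hj, hji⟩ := by simpa using h
      exact ⟨j, fun _ => ⟨hj, hji⟩⟩
    · exact ⟨0, fun h => absurd h hi⟩
  choose σ hσ using hmem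
  refine ⟨σ, hσ, ?_⟩
  have hnodup' : ((List.range k).map s').Nodup :=
    List.Nodup.map_on (fun x hx y hy h =>
      hs' (by simpa using hx) (by simpa using hy) h) List.nodup_range
  have hΓ : ((List.range n).map Γ).Nodup :=
    Multiset.coe_nodup.1 (Multiset.nodup_of_le hle' (Multiset.coe_nodup.2 hnodup'))
  have hnodup : ((List.range n).map (fun i => s (σ i))).Nodup := by
    refine List.Nodup.map_on (fun x hx y hy h => ?_) List.nodup_range
    refine List.inj_on_of_nodup_map hΓ hx hy ?_
    rw [List.mem_range] at hx hy
    rw [← (hσ x hx).2, ← (hσ y hy).2, hs (hσ x hx).1 (hσ y hy).1 h]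
  refine (Multiset.le_iff_subset (Multiset.coe_nodup.2 hnodup)).2 fun a ha => ?_
  obtain ⟨i, hi, rfl⟩ := by simpa using ha
  simpa using ⟨σ i, (hσ i hi).1, rfl⟩

/-- If the left endpoints of `Δ 0, …, Δ (k-1)` and of `Δ' 0, …, Δ' (k-1)` are both strictly
decreasing, with `b(Δ i) ≤ b(Δ' i)` and `e(Δ' i) = e(Δ i)`, then balancedness of the first family
implies balancedness of the second, even after discarding some segments. -/
theorem MSBalanced.filter_of_fst_le {k : ℕ} {s s' : ℕ → ℤ × ℤ}
    {p : ℤ × ℤ → Prop} [DecidablePred p]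
    (hbal : MSBalanced (((List.range k).map s : List (ℤ × ℤ)) : Multiset (ℤ × ℤ)))
    (hs : ∀ i j, i < j → j < k → (s j).1 < (s i).1)
    (hs' : ∀ i j, i < j → j < k → (s' j).1 < (s' i).1)
    (hfst : ∀ i < k, (s i).1 ≤ (s' i).1) (hsnd : ∀ i < k, (s' i).2 = (s i).2) :
    MSBalanced (Multiset.filter p
      (((List.range k).map s' : List (ℤ × ℤ)) : Multiset (ℤ × ℤ))) := by
  have inj : ∀ t : ℕ → ℤ × ℤ, (∀ i j, i < j → j < k → (t j).1 < (t i).1) →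
      ∀ i < k, ∀ j < k, (t i).1 = (t j).1 → i = j := by
    intro t ht i hi j hj h
    by_contra hne
    rcases Nat.lt_or_gt_of_ne hne with h' | h'
    · exact absurd h (ht i j h' hj).ne'
    · exact absurd h (ht j i h' hi).ne
  have hlt : ∀ i < k, ∀ j < k, (s' i).1 < (s' j).1 → (s i).1 < (s j).1 := by
    intro i hi j hj h
    rcases Nat.lt_trichotomy i j with h' | rfl | h'
    · exact absurd h (hs' i j h' hj).not_gt
    · exact absurd h (lt_irrefl _)
    · exact hs j i h' hi
  have hprec : ∀ i < k, ∀ j < k, SegPrec (s' i) (s' j) → SegPrec (s i) (s j) := by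
    rintro i hi j hj ⟨h1, h2, h3⟩
    have := hlt i hi j hj (by omega)
    have := hfst j hj
    rw [hsnd i hi] at h2 h3
    rw [hsnd j hj] at h3
    exact ⟨by omega, by omega, h3⟩
  have hsinj : Set.InjOn s {i | i < k} := fun i hi j hj h =>
    inj s hs i hi j hj (congrArg Prod.fst h)
  have hsinj' : Set.InjOn s' {i | i < k} := fun i hi j hj h =>
    inj s' hs' i hi j hj (congrArg Prod.fst h)
  obtain ⟨⟨-, hsndnodup⟩, h4231, h3412⟩ := hbal
  refine ⟨⟨?_, ?_⟩, ?_, ?_⟩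
  · refine Multiset.nodup_of_le (Multiset.map_le_map (Multiset.filter_le _ _)) ?_
    rw [Multiset.map_coe, Multiset.coe_nodup, List.map_map]
    exact List.Nodup.map_on (fun x hx y hy h =>
      inj s' hs' x (by simpa using hx) y (by simpa using hy) h) List.nodup_range
  · refine Multiset.nodup_of_le (Multiset.map_le_map (Multiset.filter_le _ _)) ?_
    rw [Multiset.map_coe, Multiset.coe_nodup, List.map_map] at hsndnodup ⊢
    rwa [List.map_congr_left (f := Prod.snd ∘ s') (g := Prod.snd ∘ s)
      fun x hx => hsnd x (List.mem_range.1 hx)]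
  · rintro ⟨n, Γ, ⟨hn, hchain, h1, h2, h3, h4⟩, hle⟩
    obtain ⟨σ, hσ, hle'⟩ := exists_index_of_map_range_le_filter hsinj hsinj' hle
    have hb : ∀ i < n, ∀ j < n, (Γ i).1 < (Γ j).1 → (s (σ i)).1 < (s (σ j)).1 := by
      intro i hi j hj h
      rw [← (hσ i hi).2, ← (hσ j hj).2] at h
      exact hlt _ (hσ i hi).1 _ (hσ j hj).1 h
    have he : ∀ i < n, (s (σ i)).2 = (Γ i).2 := fun i hi => by
      rw [← (hσ i hi).2, hsnd _ (hσ i hi).1]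
    refine h4231 ⟨n, fun i => s (σ i), ⟨hn, fun i hi hin => ?_,
      hb _ (by omega) _ (by omega) h1, hb _ (by omega) _ (by omega) h2, ?_, ?_⟩, hle'⟩
    · have h := hchain i hi hin
      rw [← (hσ i hin).2, ← (hσ (i - 1) (by omega)).2] at h
      exact hprec _ (hσ i hin).1 _ (hσ (i - 1) (by omega)).1 h
    · simpa only [he 2 (by omega), he 0 (by omega)] using h3
    · simpa only [he 1 (by omega), he 0 (by omega)] using h4
  · rintro ⟨n, Γ, ⟨hn, hchain, h0, h1, h2, h3, h4, h5, h6⟩, hle⟩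
    obtain ⟨σ, hσ, hle'⟩ := exists_index_of_map_range_le_filter hsinj hsinj' hle
    have hb : ∀ i < n, ∀ j < n, (Γ i).1 < (Γ j).1 → (s (σ i)).1 < (s (σ j)).1 := by
      intro i hi j hj h
      rw [← (hσ i hi).2, ← (hσ j hj).2] at h
      exact hlt _ (hσ i hi).1 _ (hσ j hj).1 h
    have he : ∀ i < n, (s (σ i)).2 = (Γ i).2 := fun i hi => by
      rw [← (hσ i hi).2, hsnd _ (hσ i hi).1]
    have hc : ∀ i < n, ∀ j < n, SegPrec (Γ i) (Γ j) → SegPrec (s (σ i)) (s (σ j)) := by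
      intro i hi j hj h
      rw [← (hσ i hi).2, ← (hσ j hj).2] at h
      exact hprec _ (hσ i hi).1 _ (hσ j hj).1 h
    refine h3412 ⟨n, fun i => s (σ i), ⟨hn,
      fun i hi hin => hc _ hin _ (by omega) (hchain i hi hin),
      hc _ (by omega) _ (by omega) h0, hb _ (by omega) _ (by omega) h1,
      hb _ (by omega) _ (by omega) h2, hb _ (by omega) _ (by omega) h3, ?_, ?_, ?_⟩, hle'⟩
    · simpa only [he 3 (by omega), he 1 (by omega)] using h4
    · simpa only [he 1 (by omega), he 2 (by omega)] using h5
    · simpa only [he 2 (by omega), he 0 (by omega)] using h6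

/-- Let `Δ_1, …, Δ_k` (`k ≥ 1`) be segments forming a balanced
multisegment with `b(Δ_1) > … > b(Δ_k)`.  (Here `seg i` encodes `Δ_{i+1}`, i.e.
`Δ_j = seg (j-1)` for the 1-based paper index `j`.)  Let `m` be the largest index with
`e(Δ_1) > … > e(Δ_m)` and `l'` the smallest index with `1 ≤ l' ≤ m` such that
`b(Δ_i) = b(Δ_{i+1}) + 1` for all `l' ≤ i < m`.  Define `Δ'_i = [b(Δ_i)+1, e(Δ_i)]`
for `l' ≤ i ≤ m` and `Δ'_i = Δ_i` otherwise.  Then the multisegment `𝔪'` formed by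
the nonempty `Δ'_i` (i.e. those with `b ≤ e`, the empty ones being discarded via the
filter) is regular and balanced. -/
theorem stmt10
    (k : ℕ) (hk : 1 ≤ k) (seg : ℕ → ℤ × ℤ)
    (hseg : ∀ i < k, (seg i).1 ≤ (seg i).2)
    (hbal : MSBalanced (((List.range k).map seg : List (ℤ × ℤ)) : Multiset (ℤ × ℤ)))
    (hbdec : ∀ i j, i < j → j < k → (seg j).1 < (seg i).1)
    (m : ℕ) (hm1 : 1 ≤ m) (hmk : m ≤ k)
    (hmdec : ∀ i j, i < j → j < m → (seg j).2 < (seg i).2)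
    (hmmax : ∀ m', m < m' → m' ≤ k →
      ¬ (∀ i j, i < j → j < m' → (seg j).2 < (seg i).2))
    (l' : ℕ) (hl'1 : 1 ≤ l') (hl'm : l' ≤ m)
    (hl'prop : ∀ i, l' ≤ i → i < m → (seg (i - 1)).1 = (seg i).1 + 1)
    (hl'min : ∀ t, 1 ≤ t → t < l' →
      ¬ (∀ i, t ≤ i → i < m → (seg (i - 1)).1 = (seg i).1 + 1))
    (seg' : ℕ → ℤ × ℤ)
    (hseg' : ∀ j, seg' j =
      if l' ≤ j + 1 ∧ j + 1 ≤ m then ((seg j).1 + 1, (seg j).2) else seg j) :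
    MSRegular (Multiset.filter (fun Δ => Δ.1 ≤ Δ.2)
      (((List.range k).map seg' : List (ℤ × ℤ)) : Multiset (ℤ × ℤ))) ∧
    MSBalanced (Multiset.filter (fun Δ => Δ.1 ≤ Δ.2)
      (((List.range k).map seg' : List (ℤ × ℤ)) : Multiset (ℤ × ℤ))) := by
  have hgap : 2 ≤ l' → (seg (l' - 1)).1 + 1 < (seg (l' - 2)).1 := by
    intro h2
    have hlt := hbdec (l' - 2) (l' - 1) (by omega) (by omega)
    refine lt_of_le_of_ne (by omega) fun heq => ?_
    refine hl'min (l' - 1) (by omega) (by omega) fun i hi him => ?_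
    rcases hi.eq_or_lt with rfl | hi'
    · exact heq.symm
    · exact hl'prop i (by omega) him
  have hdec' : ∀ i j, i < j → j < k → (seg' j).1 < (seg' i).1 := by
    intro i j hij hj
    have hlt := hbdec i j hij hj
    rw [hseg' i, hseg' j]
    split_ifs with hjt hit hit
    · simpa using hlt
    · have hgap := hgap (by omega)
      have hi : (seg (l' - 2)).1 ≤ (seg i).1 := by
        rcases (show i ≤ l' - 2 by omega).eq_or_lt with rfl | h
        · rfl
        · exact (hbdec _ _ h (by omega)).le
      have hj' : (seg j).1 ≤ (seg (l' - 1)).1 := by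
        rcases (show l' - 1 ≤ j by omega).eq_or_lt with rfl | h
        · rfl
        · exact (hbdec _ _ h hj).le
      change (seg j).1 + 1 < (seg i).1
      omega
    · change (seg j).1 < (seg i).1 + 1
      omega
    · exact hlt
  have hbal' := hbal.filter_of_fst_le (p := fun Δ => Δ.1 ≤ Δ.2) hbdec hdec'
    (fun i _ => by rw [hseg' i]; split_ifs <;> simp)
    (fun i _ => by rw [hseg' i]; split_ifs <;> rfl)
  exact ⟨hbal'.1, hbal'⟩
end

section
/- Let Δ_1, …, Δ_k (k ≥ 1) be segments forming a regular multisegment, indexed so that b(Δ_1) > … > b(Δ_k). Let m be the largest index in {1, …, k} such that e(Δ_1) > … > e(Δ_m), and let l be the smallest index with 1 ≤ l ≤ m such that Δ_{i+1} ≺ Δ_i for all l ≤ i < m. Then Δ_l does not precede Δ_i (i.e., ¬(Δ_l ≺ Δ_i)) for every i ∈ {1, …, k}. -/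
/-- Let `Δ_1, …, Δ_k` (`k ≥ 1`) be segments forming a regular
multisegment with `b(Δ_1) > … > b(Δ_k)`.  (Here `seg i` encodes `Δ_{i+1}`, i.e.
`Δ_j = seg (j-1)` for the 1-based paper index `j`.)  Let `m` be the largest index with
`e(Δ_1) > … > e(Δ_m)` and `l` the smallest index with `1 ≤ l ≤ m` such that
`Δ_{i+1} ≺ Δ_i` for all `l ≤ i < m`.  Then `¬(Δ_l ≺ Δ_i)` for every `i ∈ {1,…,k}`. -/
theorem stmt11
    (k : ℕ) (hk : 1 ≤ k) (seg : ℕ → ℤ × ℤ)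
    (hseg : ∀ i < k, (seg i).1 ≤ (seg i).2)
    (hreg : MSRegular (((List.range k).map seg : List (ℤ × ℤ)) : Multiset (ℤ × ℤ)))
    (hbdec : ∀ i j, i < j → j < k → (seg j).1 < (seg i).1)
    (m : ℕ) (hm1 : 1 ≤ m) (hmk : m ≤ k)
    (hmdec : ∀ i j, i < j → j < m → (seg j).2 < (seg i).2)
    (hmmax : ∀ m', m < m' → m' ≤ k →
      ¬ (∀ i j, i < j → j < m' → (seg j).2 < (seg i).2))
    (l : ℕ) (hl1 : 1 ≤ l) (hlm : l ≤ m)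
    (hlprec : ∀ i, l ≤ i → i < m → SegPrec (seg i) (seg (i - 1)))
    (hlmin : ∀ l', 1 ≤ l' → l' < l →
      ¬ (∀ i, l' ≤ i → i < m → SegPrec (seg i) (seg (i - 1)))) :
    ∀ i, 1 ≤ i → i ≤ k → ¬ SegPrec (seg (l - 1)) (seg (i - 1)) := by
  rintro i hi hik ⟨hb, hbe, _⟩
  have hil : i < l := by
    by_contra h
    rcases (show l - 1 ≤ i - 1 by omega).eq_or_lt with h | h
    · rw [h] at hb
      omega
    · have := hbdec _ _ h (by omega)
      omega
  have hb_le : (seg (l - 1 - 1)).1 ≤ (seg (i - 1)).1 := by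
    rcases (show i - 1 ≤ l - 1 - 1 by omega).eq_or_lt with h | h
    · rw [h]
    · exact (hbdec _ _ h (by omega)).le
  have hb_lt := hbdec (l - 1 - 1) (l - 1) (by omega) (by omega)
  have he_lt := hmdec (l - 1 - 1) (l - 1) (by omega) (by omega)
  refine hlmin (l - 1) (by omega) (by omega) fun j hj hjm => ?_
  rcases hj.eq_or_lt with rfl | hj
  · exact ⟨by omega, by omega, by omega⟩
  · exact hlprec j (by omega) hjm
end
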